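/- arXiv:1703.04143 — 4 statements merged into one kernel-verified Lean document; each statement's English description precedes it below -/
import Mathlib

section
/- (Algebraic correctness of the Fast Exponential Bernoulli Race rescaling.) Let λ > 4, set ε = 1/λ, let v ∈ [0,1]^m with v_max = max_i v_i, and let z ∈ [0,1] satisfy v_max − ε ≤ z ≤ v_max + ε. Define v'_i = (1 − 2ε)·v_i + (1 − 2ε)·(1 − z) for each i and λ' = λ/(1 − 2ε). Then: (i) 0 ≤ v'_i ≤ 1 − ε for every i; (ii) max_i v'_i ≥ 1 − 3ε; and (iii) for every i, e^{λ' v'_i} / ∑_j e^{λ' v'_j} = e^{λ v_i} / ∑_j e^{λ v_j}, i.e., the exponential-weights distribution with parameter λ' on v' equals the exponential-weights distribution with parameter λ on v. -/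
/-- **Algebraic correctness of the Fast Exponential Bernoulli Race rescaling.** Let `λ > 4`,
`ε = 1/λ`, `v ∈ [0,1]^m` with `v_max = max_i v_i`, and let `z ∈ [0,1]` with
`v_max - ε ≤ z ≤ v_max + ε`.  Define `v'_i = (1-2ε) v_i + (1-2ε)(1-z)` and `λ' = λ/(1-2ε)`.
Then (i) `0 ≤ v'_i ≤ 1 - ε` for every `i`; (ii) `max_i v'_i ≥ 1 - 3ε`; (iii) the
exponential-weights distribution with parameter `λ'` on `v'` equals the exponential-weights
distribution with parameter `λ` on `v`. -/
theorem fast_exponential_bernoulli_race_rescaling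
    (m : ℕ) [NeZero m] (lam : ℝ) (hlam : 4 < lam)
    (ε : ℝ) (hε : ε = 1 / lam)
    (v : Fin m → ℝ) (hv : ∀ i, v i ∈ Set.Icc (0 : ℝ) 1)
    (vmax : ℝ) (hvmax : vmax = Finset.univ.sup' Finset.univ_nonempty v)
    (z : ℝ) (hz : z ∈ Set.Icc (0 : ℝ) 1)
    (hz1 : vmax - ε ≤ z) (hz2 : z ≤ vmax + ε)
    (v' : Fin m → ℝ)
    (hv' : ∀ i, v' i = (1 - 2 * ε) * v i + (1 - 2 * ε) * (1 - z))
    (lam' : ℝ) (hlam' : lam' = lam / (1 - 2 * ε)) :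
    (∀ i, 0 ≤ v' i ∧ v' i ≤ 1 - ε) ∧
    (Finset.univ.sup' Finset.univ_nonempty v' ≥ 1 - 3 * ε) ∧
    (∀ i, Real.exp (lam' * v' i) / ∑ j, Real.exp (lam' * v' j)
        = Real.exp (lam * v i) / ∑ j, Real.exp (lam * v j)) := by
  have hε0 : 0 < ε := by rw [hε]; positivity
  have hε4 : ε < 1 / 4 := by
    rw [hε]
    exact one_div_lt_one_div_of_lt (by norm_num) hlam
  have hpos : 0 < 1 - 2 * ε := by linarith
  have hle : ∀ i, v i ≤ vmax := fun i => hvmax ▸ Finset.le_sup' v (Finset.mem_univ i)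
  refine ⟨fun i => ⟨?_, ?_⟩, ?_, fun i => ?_⟩
  · have h1 := mul_nonneg hpos.le (hv i).1
    have h2 := mul_nonneg hpos.le (sub_nonneg.2 hz.2)
    linarith [hv' i]
  · have h : (1 - 2 * ε) * (v i + 1 - z) ≤ (1 - 2 * ε) * (1 + ε) :=
      mul_le_mul_of_nonneg_left (by linarith [hle i]) hpos.le
    nlinarith [hv' i, sq_nonneg ε]
  · obtain ⟨i, -, hi⟩ := Finset.exists_mem_eq_sup' Finset.univ_nonempty v
    have h : (1 - 2 * ε) * (1 - ε) ≤ (1 - 2 * ε) * (v i + 1 - z) :=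
      mul_le_mul_of_nonneg_left (by linarith) hpos.le
    refine le_trans ?_ (Finset.le_sup' v' (Finset.mem_univ i))
    nlinarith [hv' i, sq_nonneg ε]
  · have h : ∀ j, Real.exp (lam' * v' j) = Real.exp (lam * v j) * Real.exp (lam * (1 - z)) := by
      intro j
      rw [← Real.exp_add, hv', hlam', ← mul_add, ← mul_assoc, div_mul_cancel₀ _ hpos.ne', mul_add]
    simp_rw [h, ← Finset.sum_mul]
    exact mul_div_mul_right _ _ (Real.exp_ne_zero _)
end

section
/- (Monotonicity of per-replica matching welfare in the load.) Let T be a measurable space, μ a probability measure on T, w : T × T → [0,1] a measurable weight function, and m, k ≥ 1 integers. For replicas R_1,…,R_{km} drawn i.i.d. from μ and surrogates S_1,…,S_m drawn i.i.d. from μ, independently, let OPT_k denote the maximum of ∑_{i,j} x_{ij}·w(R_i, S_j) over fractional assignments x ≥ 0 with ∑_j x_{ij} ≤ 1 for every replica i and ∑_i x_{ij} ≤ k for every surrogate j. Then E[OPT_k]/(km) ≥ E[OPT_1]/m, where E[OPT_1] is the analogous expected optimal value with m i.i.d. replicas, m i.i.d. surrogates, and load k = 1. -/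
open MeasureTheory

/-- The value of the maximum-weight fractional `k`-to-`1` matching between `R` replicas and
`S` surrogates with weights `w`: the supremum of `∑_{i,j} x_{ij} w_{ij}` over matrices `x ≥ 0`
with row sums at most `1` and column sums at most `k`. -/
noncomputable def matchOPT (R S : ℕ) (k : ℕ) (w : Fin R → Fin S → ℝ) : ℝ :=
  sSup {val : ℝ | ∃ x : Fin R → Fin S → ℝ,
    (∀ i j, 0 ≤ x i j) ∧ (∀ i, ∑ j, x i j ≤ 1) ∧ (∀ j, ∑ i, x i j ≤ (k : ℝ)) ∧
    val = ∑ i, ∑ j, x i j * w i j}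

open ProbabilityTheory

lemma matchOPT_bddAbove (R S k : ℕ) (w : Fin R → Fin S → ℝ) :
    BddAbove {val : ℝ | ∃ x : Fin R → Fin S → ℝ,
      (∀ i j, 0 ≤ x i j) ∧ (∀ i, ∑ j, x i j ≤ 1) ∧ (∀ j, ∑ i, x i j ≤ (k : ℝ)) ∧
      val = ∑ i, ∑ j, x i j * w i j} := by
  refine ⟨∑ i, ∑ j, |w i j|, ?_⟩
  rintro _ ⟨x, hx0, hx1, -, rfl⟩
  refine Finset.sum_le_sum fun i _ => Finset.sum_le_sum fun j _ => ?_
  have hx : x i j ≤ 1 :=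
    (Finset.single_le_sum (fun j _ => hx0 i j) (Finset.mem_univ j)).trans (hx1 i)
  calc x i j * w i j ≤ x i j * |w i j| := mul_le_mul_of_nonneg_left (le_abs_self _) (hx0 i j)
    _ ≤ |w i j| := mul_le_of_le_one_left (abs_nonneg _) hx

lemma le_matchOPT {R S k : ℕ} {w x : Fin R → Fin S → ℝ} (hx0 : ∀ i j, 0 ≤ x i j)
    (hx1 : ∀ i, ∑ j, x i j ≤ 1) (hxk : ∀ j, ∑ i, x i j ≤ (k : ℝ)) :
    ∑ i, ∑ j, x i j * w i j ≤ matchOPT R S k w :=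
  le_csSup (matchOPT_bddAbove R S k w) ⟨x, hx0, hx1, hxk, rfl⟩

lemma matchOPT_nonempty (R S k : ℕ) (w : Fin R → Fin S → ℝ) :
    {val : ℝ | ∃ x : Fin R → Fin S → ℝ,
      (∀ i j, 0 ≤ x i j) ∧ (∀ i, ∑ j, x i j ≤ 1) ∧ (∀ j, ∑ i, x i j ≤ (k : ℝ)) ∧
      val = ∑ i, ∑ j, x i j * w i j}.Nonempty :=
  ⟨_, 0, by simp, by simp, by simp, rfl⟩

lemma exists_lt_matching (R S k : ℕ) (w : Fin R → Fin S → ℝ) {ε : ℝ} (hε : 0 < ε) :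
    ∃ x : Fin R → Fin S → ℝ,
      (∀ i j, 0 ≤ x i j) ∧ (∀ i, ∑ j, x i j ≤ 1) ∧ (∀ j, ∑ i, x i j ≤ (k : ℝ)) ∧
      matchOPT R S k w - ε < ∑ i, ∑ j, x i j * w i j := by
  obtain ⟨_, ⟨x, hx0, hx1, hxk, rfl⟩, hlt⟩ :=
    exists_lt_of_lt_csSup (matchOPT_nonempty R S k w) (sub_lt_self (matchOPT R S k w) hε)
  exact ⟨x, hx0, hx1, hxk, hlt⟩

lemma matchOPT_nonneg (R S k : ℕ) (w : Fin R → Fin S → ℝ) : 0 ≤ matchOPT R S k w := by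
  simpa using le_matchOPT (k := k) (w := w) (x := 0) (by simp) (by simp) (by simp)

lemma matchOPT_le (R S k : ℕ) (w : Fin R → Fin S → ℝ) (hw : ∀ i j, w i j ≤ 1) :
    matchOPT R S k w ≤ R := by
  refine csSup_le (matchOPT_nonempty R S k w) ?_
  rintro _ ⟨x, hx0, hx1, -, rfl⟩
  calc ∑ i, ∑ j, x i j * w i j ≤ ∑ i, ∑ j, x i j :=
        Finset.sum_le_sum fun i _ => Finset.sum_le_sum fun j _ =>
          mul_le_of_le_one_right (hx0 i j) (hw i j)
    _ ≤ ∑ _i : Fin R, 1 := Finset.sum_le_sum fun i _ => hx1 i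
    _ = R := by simp

/-- Splitting the replicas into `k` groups and matching each group separately to the surrogates
yields a `k`-to-`1` matching. -/
lemma sum_matchOPT_le (m n k : ℕ) (w : Fin (k * m) → Fin n → ℝ) :
    ∑ g : Fin k, matchOPT m n 1 (fun i => w (finProdFinEquiv (g, i)))
      ≤ matchOPT (k * m) n k w := by
  refine le_of_forall_pos_le_add fun ε hε => ?_
  have hε' : 0 < ε / (k + 1) := by positivity
  choose x hx0 hx1 hxk hlt using fun g : Fin k =>
    exists_lt_matching m n 1 (fun i => w (finProdFinEquiv (g, i))) hε'
  have hle := le_matchOPT (k := k) (w := w)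
    (x := fun a => x (finProdFinEquiv.symm a).1 (finProdFinEquiv.symm a).2)
    (fun _ _ => hx0 _ _ _) (fun _ => hx1 _ _) (fun j => by
      rw [← finProdFinEquiv.sum_comp, Fintype.sum_prod_type]
      simp only [Equiv.symm_apply_apply]
      refine (Finset.sum_le_sum fun g _ => hxk g j).trans ?_
      simp)
  rw [← finProdFinEquiv.sum_comp, Fintype.sum_prod_type] at hle
  simp only [Equiv.symm_apply_apply] at hle
  have hsum := Finset.sum_le_sum fun (g : Fin k) (_ : g ∈ Finset.univ) => (hlt g).le
  rw [Finset.sum_sub_distrib, Finset.sum_const, Finset.card_univ, Fintype.card_fin,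
    nsmul_eq_mul] at hsum
  have hkε : (k : ℝ) * (ε / (k + 1)) ≤ ε := by
    rw [mul_div_assoc', div_le_iff₀ (by positivity)]
    nlinarith
  linarith

lemma lowerSemicontinuous_matchOPT (R S k : ℕ) : LowerSemicontinuous (matchOPT R S k) := by
  intro w y hy
  obtain ⟨x, hx0, hx1, hxk, hlt⟩ := exists_lt_matching R S k w (sub_pos.2 hy)
  rw [sub_sub_cancel] at hlt
  have hcont : Continuous fun v : Fin R → Fin S → ℝ => ∑ i, ∑ j, x i j * v i j := by fun_prop
  filter_upwards [hcont.continuousAt.eventually_const_lt hlt] with v hv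
  exact hv.trans_le (le_matchOPT hx0 hx1 hxk)

lemma integrable_matchOPT {Ω : Type*} [MeasurableSpace Ω] (P : Measure Ω) [IsFiniteMeasure P]
    (R S k : ℕ) (W : Ω → Fin R → Fin S → ℝ) (hW : ∀ i j, Measurable fun ω => W ω i j)
    (hW1 : ∀ ω i j, W ω i j ≤ 1) : Integrable (fun ω => matchOPT R S k (W ω)) P := by
  have hmeas : Measurable fun ω => matchOPT R S k (W ω) :=
    (lowerSemicontinuous_matchOPT R S k).measurable.comp
      (measurable_pi_lambda _ fun i => measurable_pi_lambda _ fun j => hW i j)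
  refine Integrable.of_bound hmeas.aestronglyMeasurable (R : ℝ) (.of_forall fun ω => ?_)
  rw [Real.norm_of_nonneg (matchOPT_nonneg ..)]
  exact matchOPT_le _ _ _ _ (hW1 ω)

lemma measurePreserving_pi_comp_injective {T ι κ : Type*} [Fintype ι] [Fintype κ]
    [MeasurableSpace T] (μ : Measure T) [IsProbabilityMeasure μ] {e : κ → ι}
    (he : Function.Injective e) :
    MeasurePreserving (fun (r : ι → T) (i : κ) => r (e i))
      (Measure.pi fun _ => μ) (Measure.pi fun _ => μ) := by
  refine ⟨by fun_prop, ?_⟩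
  have hind : iIndepFun (fun (i : ι) (r : ι → T) => r i) (Measure.pi fun _ => μ) :=
    iIndepFun_pi (X := fun _ t => t) fun _ => aemeasurable_id
  rw [(iIndepFun_iff_map_fun_eq_pi_map
    fun i => (measurable_pi_apply (e i)).aemeasurable).1 (hind.precomp he)]
  congr 1
  funext i
  exact (measurePreserving_eval (fun _ => μ) (e i)).map_eq

/-- **Monotonicity of per-replica matching welfare in the load.** For `R_1,…,R_{km}` replicas
and `S_1,…,S_m` surrogates all drawn i.i.d. from `μ` (replicas and surrogates independent),
with measurable weights `w : T × T → [0,1]`, the expected optimal `k`-to-`1` fractional matching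
value per replica is at least the expected optimal `1`-to-`1` matching value per replica (the
latter with `m` i.i.d. replicas and `m` i.i.d. surrogates). -/
theorem per_replica_welfare_monotone_in_load
    {T : Type*} [MeasurableSpace T] (μ : Measure T) [IsProbabilityMeasure μ]
    (m k : ℕ) (hm : 1 ≤ m) (hk : 1 ≤ k)
    (w : T → T → ℝ) (hw : Measurable (Function.uncurry w))
    (hwr : ∀ a b, w a b ∈ Set.Icc (0 : ℝ) 1) :
    (∫ rs : (Fin (k * m) → T) × (Fin m → T),
        matchOPT (k * m) m k (fun i j => w (rs.1 i) (rs.2 j))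
        ∂((Measure.pi fun _ : Fin (k * m) => μ).prod (Measure.pi fun _ : Fin m => μ)))
      / (k * m)
    ≥ (∫ rs : (Fin m → T) × (Fin m → T),
        matchOPT m m 1 (fun i j => w (rs.1 i) (rs.2 j))
        ∂((Measure.pi fun _ : Fin m => μ).prod (Measure.pi fun _ : Fin m => μ)))
      / m := by
  have hwm : ∀ {n : ℕ} (i : Fin n) (j : Fin m),
      Measurable fun rs : (Fin n → T) × (Fin m → T) => w (rs.1 i) (rs.2 j) := fun i j =>
    hw.comp (f := fun rs : (Fin _ → T) × (Fin m → T) => (rs.1 i, rs.2 j)) (by fun_prop)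
  set P := (Measure.pi fun _ : Fin (k * m) => μ).prod (Measure.pi fun _ : Fin m => μ)
  set Q := (Measure.pi fun _ : Fin m => μ).prod (Measure.pi fun _ : Fin m => μ)
  have hgroup (g : Fin k) : ∫ rs, matchOPT m m 1
      (fun i j => w (rs.1 (finProdFinEquiv (g, i))) (rs.2 j)) ∂P
      = ∫ rs, matchOPT m m 1 (fun i j => w (rs.1 i) (rs.2 j)) ∂Q := by
    have hinj : Function.Injective fun i : Fin m => finProdFinEquiv (g, i) :=
      finProdFinEquiv.injective.comp (Prod.mk_right_injective g)
    have hpres : MeasurePreserving _ P Q :=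
      (measurePreserving_pi_comp_injective μ hinj).prod (MeasurePreserving.id _)
    have hint := integrable_matchOPT Q m m 1 (fun rs i j => w (rs.1 i) (rs.2 j)) hwm
      fun _ _ _ => (hwr _ _).2
    rw [← hpres.map_eq] at hint ⊢
    exact (integral_map hpres.aemeasurable hint.aestronglyMeasurable).symm
  have hle : k * ∫ rs, matchOPT m m 1 (fun i j => w (rs.1 i) (rs.2 j)) ∂Q
      ≤ ∫ rs, matchOPT (k * m) m k (fun i j => w (rs.1 i) (rs.2 j)) ∂P := by
    have hint (g : Fin k) : Integrable (fun rs => matchOPT m m 1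
        (fun i j => w (rs.1 (finProdFinEquiv (g, i))) (rs.2 j))) P :=
      integrable_matchOPT P m m 1 _ (fun _ _ => hwm _ _) fun _ _ _ => (hwr _ _).2
    calc k * ∫ rs, matchOPT m m 1 (fun i j => w (rs.1 i) (rs.2 j)) ∂Q
        = ∫ rs, ∑ g : Fin k, matchOPT m m 1
            (fun i j => w (rs.1 (finProdFinEquiv (g, i))) (rs.2 j)) ∂P := by
          rw [integral_finsetSum _ fun g _ => hint g]
          simp [hgroup]
      _ ≤ _ := integral_mono (integrable_finsetSum _ fun g _ => hint g)
          (integrable_matchOPT P _ _ _ _ hwm fun _ _ _ => (hwr _ _).2)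
          fun rs => sum_matchOPT_le m m k fun i j => w (rs.1 i) (rs.2 j)
  have hm0 : (0 : ℝ) < m := by exact_mod_cast hm
  have hk0 : (0 : ℝ) < k := by exact_mod_cast hk
  rw [ge_iff_le, ← mul_div_mul_left _ _ hk0.ne']
  gcongr
end

section
/- (Bounded differences of the regularized matching value.) Let m, k ≥ 1, δ ≥ 0, and let v, v' ∈ [0,1]^{km×m} be weight matrices that agree on all rows except possibly row i (i.e., v_{l,j} = v'_{l,j} for all l ≠ i and all j). Then |OPT_δ(v) − OPT_δ(v')| ≤ 1. -/
open MeasureTheory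

/-- The entropy-regularized matching value `OPT_δ(v)`: the supremum over fractional `k`-to-`1`
assignments `x ≥ 0` (row sums at most `1` over the `km` replicas, column sums at most `k` over
the `m` surrogates) of `∑_{i,j} x_{ij} v_{ij} - δ ∑_{i,j} x_{ij} log x_{ij}`.  The convention
`0·log 0 = 0` holds automatically since `Real.log 0 = 0`. -/
noncomputable def OPTreg (m k : ℕ) (δ : ℝ) (v : Fin (k * m) → Fin m → ℝ) : ℝ :=
  sSup {val : ℝ | ∃ x : Fin (k * m) → Fin m → ℝ,
    (∀ i j, 0 ≤ x i j) ∧ (∀ i, ∑ j, x i j ≤ 1) ∧ (∀ j, ∑ i, x i j ≤ (k : ℝ)) ∧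
    val = ∑ i, ∑ j, (x i j * v i j - δ * (x i j * Real.log (x i j)))}

/-- The set of regularized values of feasible assignments is bounded above. -/
lemma bddAbove_OPTreg_values (m k : ℕ) {δ : ℝ} (hδ : 0 ≤ δ)
    {v : Fin (k * m) → Fin m → ℝ} (hv : ∀ i j, v i j ≤ 1) :
    BddAbove {val : ℝ | ∃ x : Fin (k * m) → Fin m → ℝ,
      (∀ i j, 0 ≤ x i j) ∧ (∀ i, ∑ j, x i j ≤ 1) ∧ (∀ j, ∑ i, x i j ≤ (k : ℝ)) ∧
      val = ∑ i, ∑ j, (x i j * v i j - δ * (x i j * Real.log (x i j)))} := by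
  refine ⟨∑ _i : Fin (k * m), ∑ _j : Fin m, (1 + δ), ?_⟩
  rintro _ ⟨x, hx, hrow, -, rfl⟩
  refine Finset.sum_le_sum fun i _ => Finset.sum_le_sum fun j _ => ?_
  have hx1 : x i j ≤ 1 :=
    (Finset.single_le_sum (fun j _ => hx i j) (Finset.mem_univ j)).trans (hrow i)
  have hlog : -(x i j * Real.log (x i j)) ≤ 1 := by
    have h := Real.negMulLog_le_one_sub_self (hx i j)
    rw [Real.negMulLog] at h
    linarith [hx i j]
  have hxv : x i j * v i j ≤ x i j := mul_le_of_le_one_right (hx i j) (hv i j)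
  linarith [mul_le_mul_of_nonneg_left hlog hδ]

/-- Changing one row of the weights raises the regularized matching value by at most `1`. -/
lemma OPTreg_le_OPTreg_add_one (m k : ℕ) {δ : ℝ} (hδ : 0 ≤ δ)
    {v v' : Fin (k * m) → Fin m → ℝ}
    (hv : ∀ i j, v i j ≤ 1) (hv' : ∀ i j, v' i j ∈ Set.Icc (0 : ℝ) 1)
    (i : Fin (k * m)) (hagree : ∀ l, l ≠ i → ∀ j, v l j = v' l j) :
    OPTreg m k δ v ≤ OPTreg m k δ v' + 1 := by
  refine csSup_le ⟨_, 0, by simp, by simp, by simp, rfl⟩ ?_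
  rintro _ ⟨x, hx, hrow, hcol, rfl⟩
  have hle : ∑ l, ∑ j, (x l j * v' l j - δ * (x l j * Real.log (x l j))) ≤ OPTreg m k δ v' :=
    le_csSup (bddAbove_OPTreg_values m k hδ fun l j => (hv' l j).2) ⟨x, hx, hrow, hcol, rfl⟩
  have hdiff : ∑ l, ∑ j, (x l j * v l j - δ * (x l j * Real.log (x l j)))
      - ∑ l, ∑ j, (x l j * v' l j - δ * (x l j * Real.log (x l j)))
      = ∑ j, x i j * (v i j - v' i j) := by
    simp only [← Finset.sum_sub_distrib]
    rw [Finset.sum_eq_single i]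
    · exact Finset.sum_congr rfl fun j _ => by ring
    · intro l _ hl
      simp [hagree l hl]
    · simp
  have hone : ∑ j, x i j * (v i j - v' i j) ≤ 1 :=
    (Finset.sum_le_sum fun j _ => mul_le_of_le_one_right (hx i j)
      (by linarith [hv i j, (hv' i j).1])).trans (hrow i)
  linarith

/-- **Bounded differences of the regularized matching value.** If two weight matrices
`v, v' ∈ [0,1]^{km×m}` agree on all rows except possibly row `i`, then
`|OPT_δ(v) - OPT_δ(v')| ≤ 1`. -/
theorem OPTreg_bounded_differences
    (m k : ℕ) (hm : 1 ≤ m) (hk : 1 ≤ k)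
    (δ : ℝ) (hδ : 0 ≤ δ)
    (v v' : Fin (k * m) → Fin m → ℝ)
    (hv : ∀ i j, v i j ∈ Set.Icc (0 : ℝ) 1) (hv' : ∀ i j, v' i j ∈ Set.Icc (0 : ℝ) 1)
    (i : Fin (k * m)) (hagree : ∀ l, l ≠ i → ∀ j, v l j = v' l j) :
    |OPTreg m k δ v - OPTreg m k δ v'| ≤ 1 := by
  rw [abs_sub_le_iff]
  constructor
  · linarith [OPTreg_le_OPTreg_add_one m k hδ (fun l j => (hv l j).2) hv' i hagree]
  · linarith [OPTreg_le_OPTreg_add_one m k hδ (fun l j => (hv' l j).2) hv i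
      fun l hl j => (hagree l hl j).symm]
end

section
/- (Concentration of the regularized matching value over random replicas.) Let T be a measurable space, μ a probability measure on T, m ≥ 2, k ≥ 1, δ > 0, and w : T × {1,…,m} → [0,1] measurable. Let R_1,…,R_{km} be i.i.d. draws from μ and let V(R) be the weight matrix with entries V(R)_{ij} = w(R_i, j). Then P( |OPT_δ(V(R)) − E[OPT_δ(V(R))]| ≥ δ·km·(log m)/4 ) ≤ 2·exp(−km·δ²·(log m)²/32). -/
open MeasureTheory
open scoped ENNReal

open ProbabilityTheory in
/-- **McDiarmid's inequality**, in moment generating function form: a bounded measurable function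
of `n` i.i.d. variables which increases by at most `1` when one coordinate is changed is, once
centered, sub-Gaussian with variance proxy `n`. -/
theorem hasSubgaussianMGF_of_bounded_differences {T : Type*} [MeasurableSpace T] (μ : Measure T)
    [IsProbabilityMeasure μ] (n : ℕ) (f : (Fin n → T) → ℝ) (hf : Measurable f) (C : ℝ)
    (hC : ∀ R, |f R| ≤ C) (hd : ∀ R i t, f (Function.update R i t) ≤ f R + 1) :
    HasSubgaussianMGF (fun R => f R - ∫ R', f R' ∂(Measure.pi fun _ : Fin n => μ)) n
      (Measure.pi fun _ : Fin n => μ) := by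
  induction n generalizing C with
  | zero =>
    have h0 : (fun R => f R - ∫ R', f R' ∂(Measure.pi fun _ : Fin 0 => μ)) = fun _ => 0 := by
      funext R
      have : f = fun _ => f R := funext fun R' => congrArg f (Subsingleton.elim _ _)
      rw [this]
      simp
    rw [h0]
    exact ⟨by simp, by simp [mgf]⟩
  | succ n ih =>
    set P := Measure.pi fun _ : Fin n => μ with hP
    set E := ∫ R', f R' ∂(Measure.pi fun _ : Fin (n + 1) => μ) with hE
    have hmp := (measurePreserving_piFinSuccAbove (fun _ : Fin (n + 1) => μ) 0).symm
    have hcons : ∀ p : T × (Fin n → T),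
        (MeasurableEquiv.piFinSuccAbove (fun _ => T) 0).symm p = Fin.cons p.1 p.2 := by
      intro p
      simp [MeasurableEquiv.piFinSuccAbove_symm_apply, Fin.insertNthEquiv]
    have hint (h : (Fin (n + 1) → T) → ℝ) :
        ∫ R, h R ∂(Measure.pi fun _ : Fin (n + 1) => μ)
          = ∫ p, h (Fin.cons p.1 p.2) ∂(μ.prod P) := by
      rw [← hmp.integral_comp' h]
      simp_rw [hcons]
      rfl
    have hmeas : Measurable fun p : T × (Fin n → T) =>
        f (Fin.cons (α := fun _ => T) p.1 p.2) := by
      have := hf.comp (MeasurableEquiv.piFinSuccAbove (fun _ => T) (0 : Fin (n + 1))).symm.measurable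
      simpa only [Function.comp_def, hcons] using this
    set F : T → (Fin n → T) → ℝ := fun t r => f (Fin.cons (α := fun _ => T) t r) with hF
    have hFm (t : T) : Measurable (F t) := hmeas.comp measurable_prodMk_left
    have hFi (t : T) : Integrable (F t) P :=
      Integrable.of_mem_Icc (-C) C (hFm t).aemeasurable (.of_forall fun r => abs_le.1 (hC _))
    set g : T → ℝ := fun t => ∫ r, F t r ∂P with hg
    have hgm : Measurable g :=
      (hmeas.stronglyMeasurable.integral_prod_right' (ν := P)).measurable
    have hE' : E = ∫ t, g t ∂μ := by
      rw [hE, hint, integral_prod]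
      exact Integrable.of_mem_Icc (-C) C hmeas.aemeasurable
        (.of_forall fun r => abs_le.1 (hC _))
    have hgd (t t' : T) : g t ≤ g t' + 1 := by
      have : g t ≤ ∫ r, (F t' r + 1) ∂P := by
        refine integral_mono (hFi t) ((hFi t').add (integrable_const _)) fun r => ?_
        have := hd (Fin.cons (α := fun _ => T) t' r) 0 t
        rwa [Fin.update_cons_zero] at this
      rwa [integral_add (hFi t') (integrable_const _), integral_const, probReal_univ,
        one_smul] at this
    obtain ⟨t₀⟩ : Nonempty T := nonempty_of_isProbabilityMeasure μ
    have hgsub : HasSubgaussianMGF (fun t => g t - E) 1 μ := by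
      have := hasSubgaussianMGF_of_mem_Icc (μ := μ) (a := g t₀ - 1) (b := g t₀ + 1)
        hgm.aemeasurable (.of_forall fun t => ⟨by linarith [hgd t₀ t], hgd t t₀⟩)
      rw [hE']
      convert this using 1
      rw [show g t₀ + 1 - (g t₀ - 1) = 2 by ring]
      ext
      norm_num
    have hFsub (t : T) : HasSubgaussianMGF (fun r => F t r - g t) n P := by
      refine ih (F t) (hFm t) C (fun r => hC _) fun r i t' => ?_
      have := hd (Fin.cons (α := fun _ => T) t r) i.succ t'
      rwa [← Fin.cons_update] at this
    have hexp (s : ℝ) : Integrable (fun R => Real.exp (s * (f R - E)))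
        (Measure.pi fun _ : Fin (n + 1) => μ) := by
      refine integrable_exp_mul_of_mem_Icc (a := -C - E) (b := C - E) (hf.sub_const _).aemeasurable
        (.of_forall fun R => ?_)
      have := abs_le.1 (hC R)
      exact ⟨by linarith [this.1], by linarith [this.2]⟩
    refine ⟨hexp, fun s => ?_⟩
    have hexp' : Integrable (fun p : T × (Fin n → T) => Real.exp (s * (F p.1 p.2 - E)))
        (μ.prod P) := by
      refine integrable_exp_mul_of_mem_Icc (X := fun p : T × (Fin n → T) => F p.1 p.2 - E)
        (a := -C - E) (b := C - E) (hmeas.sub_const _).aemeasurable (.of_forall fun p => ?_)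
      have := abs_le.1 (hC (Fin.cons (α := fun _ => T) p.1 p.2))
      exact ⟨by linarith [this.1], by linarith [this.2]⟩
    calc mgf (fun R => f R - E) (Measure.pi fun _ : Fin (n + 1) => μ) s
        = ∫ t, ∫ r, Real.exp (s * (F t r - E)) ∂P ∂μ := by
          rw [mgf, hint]
          exact integral_prod _ hexp'
      _ ≤ ∫ t, Real.exp (n * s ^ 2 / 2) * Real.exp (s * (g t - E)) ∂μ := by
          refine integral_mono hexp'.integral_prod_left
            ((hgsub.integrable_exp_mul s).const_mul _) fun t => ?_
          have hsplit : ∀ r, Real.exp (s * (F t r - E))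
              = Real.exp (s * (F t r - g t)) * Real.exp (s * (g t - E)) := by
            intro r
            rw [← Real.exp_add]
            ring_nf
          simp only [hsplit]
          rw [integral_mul_const]
          gcongr
          exact (hFsub t).mgf_le s
      _ ≤ Real.exp (n * s ^ 2 / 2) * Real.exp (1 * s ^ 2 / 2) := by
          rw [integral_const_mul]
          gcongr
          exact hgsub.mgf_le s
      _ = Real.exp (((n + 1 : ℕ) : NNReal) * s ^ 2 / 2) := by
          rw [← Real.exp_add]
          push_cast
          ring_nf

/-- Raising the weights in row `i` by at most `c i` raises the regularized matching value by at
most `∑ i, c i`. -/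
theorem OPTreg_le_add (m k : ℕ) (δ : ℝ) (hδ : 0 ≤ δ) (v v' : Fin (k * m) → Fin m → ℝ)
    (c : Fin (k * m) → ℝ) (hc : ∀ i, 0 ≤ c i) (h : ∀ i j, v i j ≤ v' i j + c i) :
    OPTreg m k δ v ≤ OPTreg m k δ v' + ∑ i, c i := by
  refine csSup_le ⟨_, fun _ _ => 0, by simp, by simp, by simp, rfl⟩ ?_
  rintro _ ⟨x, hx, hrow, hcol, rfl⟩
  have hbdd : BddAbove {val : ℝ | ∃ x : Fin (k * m) → Fin m → ℝ,
      (∀ i j, 0 ≤ x i j) ∧ (∀ i, ∑ j, x i j ≤ 1) ∧ (∀ j, ∑ i, x i j ≤ (k : ℝ)) ∧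
      val = ∑ i, ∑ j, (x i j * v' i j - δ * (x i j * Real.log (x i j)))} := by
    refine ⟨∑ i, ∑ j, (|v' i j| + δ), ?_⟩
    rintro _ ⟨y, hy, hyrow, -, rfl⟩
    gcongr with i _ j _
    have hy1 : y i j ≤ 1 :=
      (Finset.single_le_sum (fun j _ => hy i j) (Finset.mem_univ j)).trans (hyrow i)
    have hlog := Real.self_sub_one_le_mul_log (hy i j)
    have hv : y i j * v' i j ≤ |v' i j| :=
      (mul_le_mul_of_nonneg_left (le_abs_self _) (hy i j)).trans
        (mul_le_of_le_one_left (abs_nonneg _) hy1)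
    nlinarith [hy i j]
  have hle := le_csSup hbdd ⟨x, hx, hrow, hcol, rfl⟩
  refine le_trans ?_ (add_le_add_left hle _)
  rw [← Finset.sum_add_distrib]
  gcongr with i _
  calc ∑ j, (x i j * v i j - δ * (x i j * Real.log (x i j)))
      ≤ ∑ j, ((x i j * v' i j - δ * (x i j * Real.log (x i j))) + x i j * c i) := by
        gcongr with j _
        nlinarith [mul_le_mul_of_nonneg_left (h i j) (hx i j)]
    _ ≤ _ := by
        rw [Finset.sum_add_distrib, ← Finset.sum_mul]
        gcongr
        exact mul_le_of_le_one_left (hc i) (hrow i)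

theorem continuous_OPTreg (m k : ℕ) (δ : ℝ) (hδ : 0 ≤ δ) : Continuous (OPTreg m k δ) := by
  refine (LipschitzWith.of_le_add_mul (k * m : ℕ) fun v v' => ?_).continuous
  refine (OPTreg_le_add m k δ hδ v v' (fun _ => dist v v') (fun _ => dist_nonneg)
    fun i j => ?_).trans_eq (by simp)
  have h := (dist_le_pi_dist (v i) (v' i) j).trans (dist_le_pi_dist v v' i)
  rw [Real.dist_eq] at h
  linarith [le_abs_self (v i j - v' i j)]

/-- **Concentration of the regularized matching value over random replicas.** Let the replicas
`R_1,…,R_{km}` be i.i.d. draws from `μ` and let `V(R)_{ij} = w(R_i, j)` with `w` measurable and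
`[0,1]`-valued.  Then the regularized matching value deviates from its mean by at least
`δ·km·(log m)/4` with probability at most `2·exp(-km·δ²·(log m)²/32)`. -/
theorem OPTreg_replica_concentration
    {T : Type*} [MeasurableSpace T] (μ : Measure T) [IsProbabilityMeasure μ]
    (m k : ℕ) (hm : 2 ≤ m) (hk : 1 ≤ k)
    (δ : ℝ) (hδ : 0 < δ)
    (w : T → Fin m → ℝ) (hw : ∀ j, Measurable fun t => w t j)
    (hwr : ∀ t j, w t j ∈ Set.Icc (0 : ℝ) 1) :
    (Measure.pi fun _ : Fin (k * m) => μ)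
      {R | |OPTreg m k δ (fun i j => w (R i) j)
            - ∫ R', OPTreg m k δ (fun i j => w (R' i) j)
                ∂(Measure.pi fun _ : Fin (k * m) => μ)|
           ≥ δ * (k * m) * Real.log m / 4}
      ≤ ENNReal.ofReal (2 * Real.exp (-(k * m : ℝ) * δ ^ 2 * (Real.log m) ^ 2 / 32)) := by
  set P := Measure.pi fun _ : Fin (k * m) => μ
  set f : (Fin (k * m) → T) → ℝ := fun R => OPTreg m k δ (fun i j => w (R i) j) with hf
  have hfm : Measurable f := by
    refine (continuous_OPTreg m k δ hδ.le).measurable.comp ?_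
    exact measurable_pi_lambda _ fun i => measurable_pi_lambda _ fun j =>
      (hw j).comp (measurable_pi_apply i)
  have hC (R : Fin (k * m) → T) : |f R| ≤ |OPTreg m k δ 0| + (k * m : ℕ) := by
    have h1 := OPTreg_le_add m k δ hδ.le (fun i j => w (R i) j) 0 1 (by simp)
      fun i j => by simpa using (hwr (R i) j).2
    have h2 := OPTreg_le_add m k δ hδ.le 0 (fun i j => w (R i) j) 1 (by simp)
      fun i j => by simpa using add_nonneg (hwr (R i) j).1 zero_le_one
    simp only [Pi.one_apply, Finset.sum_const, Finset.card_univ, Fintype.card_fin, nsmul_eq_mul,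
      mul_one] at h1 h2
    rw [abs_le]
    constructor <;>
      linarith [le_abs_self (OPTreg m k δ 0), neg_abs_le (OPTreg m k δ 0)]
  have hd (R : Fin (k * m) → T) (i : Fin (k * m)) (t : T) :
      f (Function.update R i t) ≤ f R + 1 := by
    have h := OPTreg_le_add m k δ hδ.le (fun i' j => w (Function.update R i t i') j)
      (fun i j => w (R i) j) (Pi.single i 1)
      (fun i' => (Pi.single_nonneg.2 zero_le_one : (0 : Fin (k * m) → ℝ) ≤ Pi.single i 1) i') ?_
    · simpa using h
    · intro i' j
      rcases eq_or_ne i' i with rfl | hne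
      · simpa using (hwr t j).2.trans (le_add_of_nonneg_left (hwr (R i') j).1)
      · simp [hne]
  have hsub := hasSubgaussianMGF_of_bounded_differences μ (k * m) f hfm _ hC hd
  set E := ∫ R, f R ∂P
  set ε := δ * (k * m) * Real.log m / 4 with hε
  have hε0 : 0 ≤ ε := by
    have := Real.log_natCast_nonneg m
    positivity
  have hexponent : -ε ^ 2 / (2 * ((k * m : ℕ) : NNReal))
      = -(k * m : ℝ) * δ ^ 2 * (Real.log m) ^ 2 / 32 := by
    have hk0 : (k : ℝ) ≠ 0 := by positivity
    have hm0 : (m : ℝ) ≠ 0 := by positivity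
    rw [hε]
    push_cast
    field_simp
    ring
  have hupper := hsub.measure_ge_le hε0
  have hlower := hsub.neg.measure_ge_le hε0
  rw [hexponent] at hupper hlower
  have hsubset : {R | |f R - E| ≥ ε} ⊆ {R | ε ≤ f R - E} ∪ {R | ε ≤ (-fun R => f R - E) R} :=
    fun R hR => (le_abs.1 (show ε ≤ |f R - E| from hR) : ε ≤ f R - E ∨ ε ≤ -(f R - E))
  rw [← ofReal_measureReal]
  refine ENNReal.ofReal_le_ofReal ?_
  calc P.real {R | |f R - E| ≥ ε}
      ≤ _ := (measureReal_mono hsubset).trans (measureReal_union_le _ _)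
    _ ≤ _ := by linarith
end
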